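/- Let p be a prime, let φ : ℕ → ℤ be monotone with φ(k) → ∞ and with U_φ := {k ∈ ℕ : φ(k) > k} infinite, and define f_k(x) = p^k if |x|_p ≤ p^{-φ(k)} and 0 otherwise, and δ_k(x) = p^k if |x|_p ≤ p^{-k} and 0 otherwise. Consider the compactly supported generalized point x₀ = [(p^k)_k]. Then δ_k(p^k) = p^k ≠ 0 for every k, while f_k(p^k) = 0 for every k ∈ U_φ; since U_φ is infinite, the sequence (f_k(p^k) − δ_k(p^k))_k is not eventually zero. Consequently [(f_k)_k] ≠ ι(δ) in 𝒢(ℚ_p), although their values at every standard point of ℚ_p coincide. -/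

import Mathlib

/-- For a fixed point `x ≠ 0`, the condition `‖x‖ ≤ p ^ (-ψ k)` fails eventually
if `ψ` tends to infinity. -/
theorem eventually_zpow_neg_lt_norm (p : ℕ) [hp : Fact p.Prime] {ψ : ℕ → ℤ}
    (hψ : Filter.Tendsto ψ Filter.atTop Filter.atTop) {x : ℚ_[p]} (hx : x ≠ 0) :
    ∀ᶠ k in Filter.atTop, (p : ℝ) ^ (-(ψ k)) < ‖x‖ := by
  have hp1 : (1 : ℝ) < p := mod_cast hp.out.one_lt
  filter_upwards [hψ.eventually_gt_atTop x.valuation] with k hk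
  rw [Padic.norm_eq_zpow_neg_valuation hx]
  exact zpow_lt_zpow_right₀ hp1 (by omega)


/-- For `φ : ℕ → ℤ` monotone with `φ(k) → ∞` and `U_φ = {k : φ(k) > k}` infinite, with
`f_k(x) = p^k` if `|x|_p ≤ p^{-φ(k)}` (else 0) and `δ_k(x) = p^k` if `|x|_p ≤ p^{-k}`
(else 0): at the generalized point `x₀ = [(p^k)_k]` one has `δ_k(p^k) = p^k ≠ 0` for all
`k` while `f_k(p^k) = 0` for `k ∈ U_φ`; the sequence `(f_k(p^k) - δ_k(p^k))` is not
eventually zero, so `(f_k - δ_k)` is not negligible, i.e. `[(f_k)] ≠ ι(δ)` in `𝒢(ℚ_p)`,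
although the standard point values of `f` and `δ` coincide at every point. -/
theorem stmt_14 (p : ℕ) [hp : Fact p.Prime]
    (φ : ℕ → ℤ) (hmono : Monotone φ) (htop : Filter.Tendsto φ Filter.atTop Filter.atTop)
    (hU : {k : ℕ | (k : ℤ) < φ k}.Infinite)
    (f δ : ℕ → ℚ_[p] → ℂ)
    (hf : ∀ k x, f k x = if ‖x‖ ≤ (p : ℝ) ^ (-(φ k)) then (p : ℂ) ^ k else 0)
    (hδ : ∀ k x, δ k x = if ‖x‖ ≤ (p : ℝ) ^ (-(k : ℤ)) then (p : ℂ) ^ k else 0) :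
    (∀ k, δ k ((p : ℚ_[p]) ^ k) = (p : ℂ) ^ k ∧ (p : ℂ) ^ k ≠ 0) ∧
    (∀ k : ℕ, (k : ℤ) < φ k → f k ((p : ℚ_[p]) ^ k) = 0) ∧
    (¬ ∃ N : ℕ, ∀ k ≥ N, f k ((p : ℚ_[p]) ^ k) - δ k ((p : ℚ_[p]) ^ k) = 0) ∧
    (¬ ∀ K : Set ℚ_[p], IsCompact K → ∃ N : ℕ, ∀ k ≥ N, ∀ x ∈ K, f k x - δ k x = 0) ∧
    (∀ x : ℚ_[p], ∃ N : ℕ, ∀ k ≥ N, f k x = δ k x) := by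
  have hp1 : (1 : ℝ) < p := mod_cast hp.out.one_lt
  have hpC : ∀ k : ℕ, (p : ℂ) ^ k ≠ 0 := fun k => pow_ne_zero k (mod_cast hp.out.ne_zero)
  have hδp : ∀ k, δ k ((p : ℚ_[p]) ^ k) = (p : ℂ) ^ k := fun k => by
    rw [hδ, if_pos (Padic.norm_p_pow k).le]
  have hfp : ∀ k : ℕ, (k : ℤ) < φ k → f k ((p : ℚ_[p]) ^ k) = 0 := fun k hk => by
    rw [hf, if_neg]
    rw [Padic.norm_p_pow, not_le]
    exact zpow_lt_zpow_right₀ hp1 (by omega)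
  have hne : ¬ ∃ N : ℕ, ∀ k ≥ N, f k ((p : ℚ_[p]) ^ k) - δ k ((p : ℚ_[p]) ^ k) = 0 := by
    rintro ⟨N, hN⟩
    obtain ⟨k, hk, hNk⟩ := hU.exists_gt N
    have h := hN k hNk.le
    rw [hfp k hk, hδp, zero_sub, neg_eq_zero] at h
    exact hpC k h
  refine ⟨fun k => ⟨hδp k, hpC k⟩, hfp, hne, fun h => hne ?_, fun x => ?_⟩
  · obtain ⟨N, hN⟩ := h _ (isCompact_closedBall (0 : ℚ_[p]) 1)
    refine ⟨N, fun k hk => hN k hk _ ?_⟩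
    rw [mem_closedBall_zero_iff, norm_pow]
    exact pow_le_one₀ (norm_nonneg _) Padic.norm_p_lt_one.le
  · rw [← Filter.eventually_atTop]
    rcases eq_or_ne x 0 with rfl | hx
    · refine Filter.Eventually.of_forall fun k => ?_
      have hp0 : (0 : ℝ) ≤ p := by positivity
      rw [hf, hδ, norm_zero, if_pos (zpow_nonneg hp0 _), if_pos (zpow_nonneg hp0 _)]
    · filter_upwards [eventually_zpow_neg_lt_norm p htop hx,
        eventually_zpow_neg_lt_norm p tendsto_natCast_atTop_atTop hx] with k hk hk'
      rw [hf, hδ, if_neg hk.not_ge, if_neg hk'.not_ge]
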